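/- For the continuous block model, let P_ε be the unique minimiser of J_ε over Π(μ,μ). Fix N ≥ 1 and 1 ≤ i ≠ j ≤ m_N, and set R_{N,i,j} := I_{N,i} × I_{N,j} ⊆ X × X. Then R_{N,i,j} is clopen in X × X and lim_{ε↓0} ε log P_ε(R_{N,i,j}) = −b. -/

import Mathlib

open MeasureTheory Filter Set Topology
open scoped ENNReal NNReal Classical

noncomputable section

/-- `m_n := max{2, ⌊e^{κ n}⌋}`. -/
def mseq (κ : ℝ) (n : ℕ) : ℕ := max 2 ⌊Real.exp (κ * n)⌋₊

/-- `L_n := n ^ 4`. -/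
def Lseq (n : ℕ) : ℕ := n ^ 4

/-- `ζ(3) = ∑_{n ≥ 1} n⁻³`. -/
def zeta3 : ℝ := ∑' k : ℕ, (((k : ℝ) + 1) ^ 3)⁻¹

/-- `w_n := (1/ζ(3)) n⁻³`. -/
def wseq (n : ℕ) : ℝ := (1 / zeta3) * ((n : ℝ) ^ 3)⁻¹

/-- `M_1 := 0`, `M_{n+1} := M_n + 3(m_n + 1)`. -/
def Mseq (κ : ℝ) : ℕ → ℝ
  | 0 => 0
  | 1 => 0
  | (n + 2) => Mseq κ (n + 1) + 3 * ((mseq κ (n + 1) : ℝ) + 1)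

/-- The interval `I_{n,i} := [M_n + 3i, M_n + 3i + 1]`. -/
def Iab (κ : ℝ) (n i : ℕ) : Set ℝ :=
  Set.Icc (Mseq κ n + 3 * i) (Mseq κ n + 3 * i + 1)

/-- The ambient space `X := ⋃_{n ≥ 1} ⋃_{0 ≤ i ≤ m_n} I_{n,i}`. -/
def Xset (κ : ℝ) : Set ℝ :=
  ⋃ (n : ℕ) (_ : 1 ≤ n) (i : ℕ) (_ : i ≤ mseq κ n), Iab κ n i

/-- The set of valid labels `(n,i)` with `n ≥ 1`, `0 ≤ i ≤ m_n`. -/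
def validLabel (κ : ℝ) (p : ℕ × ℕ) : Prop := 1 ≤ p.1 ∧ p.2 ≤ mseq κ p.1

/-- `λ_{n,i}`: Lebesgue measure restricted to `I_{n,i}` (a probability measure since
`|I_{n,i}| = 1`). -/
def lam (κ : ℝ) (n i : ℕ) : Measure ℝ := volume.restrict (Iab κ n i)

/-- The nonatomic marginal `μ := ∑_{n ≥ 1} ∑_{i=0}^{m_n} (w_n/(m_n+1)) λ_{n,i}`. -/
def muC (κ : ℝ) : Measure ℝ :=
  Measure.sum (fun p : ℕ × ℕ =>
    if validLabel κ p then
      ENNReal.ofReal (wseq p.1 / ((mseq κ p.1 : ℝ) + 1)) • lam κ p.1 p.2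
    else 0)

/-- The label map `ℓ : X → X^d` (junk value `(0,0)` off `X`). -/
def labl (κ : ℝ) (x : ℝ) : ℕ × ℕ :=
  if h : ∃ p : ℕ × ℕ, validLabel κ p ∧ x ∈ Iab κ p.1 p.2 then h.choose else (0, 0)

/-- The discrete block cost on labels. -/
def CdPair (a b : ℝ) (p q : ℕ × ℕ) : ℝ :=
  if p.1 = q.1 then (if p.2 = q.2 then 0 else if p.2 = 0 ∨ q.2 = 0 then a else b)
  else ((Lseq p.1 : ℝ) + (Lseq q.1 : ℝ))

/-- The continuous cost `C(x,y) := C^d(ℓ(x), ℓ(y))`. -/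
def Ccont (a b κ : ℝ) (p : ℝ × ℝ) : ℝ := CdPair a b (labl κ p.1) (labl κ p.2)

/-- The block-product plan `P^* := ∑_α μ^d(α) (λ_α ⊗ λ_α)`. -/
def PstarC (κ : ℝ) : Measure (ℝ × ℝ) :=
  Measure.sum (fun p : ℕ × ℕ =>
    if validLabel κ p then
      ENNReal.ofReal (wseq p.1 / ((mseq κ p.1 : ℝ) + 1)) •
        ((lam κ p.1 p.2).prod (lam κ p.1 p.2))
    else 0)

/-- Relative entropy (Kullback–Leibler divergence). -/
def KL {Ω : Type*} [MeasurableSpace Ω] (P Q : Measure Ω) : EReal :=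
  if P ≪ Q ∧ Integrable (fun x => Real.log ((P.rnDeriv Q x).toReal)) P
  then ((∫ x, Real.log ((P.rnDeriv Q x).toReal) ∂P : ℝ) : EReal) else ⊤

/-- Couplings with prescribed marginals. -/
def couplings {X Y : Type*} [MeasurableSpace X] [MeasurableSpace Y]
    (μ : Measure X) (ν : Measure Y) : Set (Measure (X × Y)) :=
  {P | IsProbabilityMeasure P ∧ P.map Prod.fst = μ ∧ P.map Prod.snd = ν}

/-- Entropic functional. -/
def Jfun {Z : Type*} [MeasurableSpace Z] (C : Z → ℝ) (R : Measure Z) (ε : ℝ)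
    (P : Measure Z) : EReal :=
  ((∫⁻ z, ENNReal.ofReal (C z) ∂P : ℝ≥0∞) : EReal) + (ε : EReal) * KL P R

/-- Extended logarithm on `ℝ≥0∞` (with `log 0 = ⊥`, `log ⊤ = ⊤`). -/
def elog (x : ℝ≥0∞) : EReal :=
  if x = 0 then ⊥ else if x = ⊤ then ⊤ else ((Real.log x.toReal : ℝ) : EReal)

section EntropicExchange

open InformationTheory

/-- On probability measures, `KL` is the Kullback–Leibler divergence of Mathlib. -/
lemma KL_eq_klDiv {Ω : Type*} [MeasurableSpace Ω] (P Q : Measure Ω)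
    [IsProbabilityMeasure P] [IsProbabilityMeasure Q] :
    KL P Q = (klDiv P Q : EReal) := by
  unfold KL
  split_ifs with h
  · have h0 := integral_llr_add_sub_measure_univ_nonneg h.1 h.2
    rw [klDiv_of_ac_of_integrable h.1 h.2]
    simp only [probReal_univ, add_sub_cancel_right] at h0 ⊢
    rw [EReal.coe_ennreal_ofReal, max_eq_left h0]
    rfl
  · have : klDiv P Q = ⊤ := by
      rw [klDiv_eq_top_iff]
      intro h1 h2
      exact h ⟨h1, h2⟩
    rw [this, EReal.coe_ennreal_top]

lemma Jfun_eq_coe {Z : Type*} [MeasurableSpace Z] (C : Z → ℝ) (R P : Measure Z)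
    [IsProbabilityMeasure P] [IsProbabilityMeasure R] {ε : ℝ} (hε : 0 < ε) :
    Jfun C R ε P =
      ((∫⁻ z, ENNReal.ofReal (C z) ∂P + ENNReal.ofReal ε * klDiv P R : ℝ≥0∞) : EReal) := by
  rw [Jfun, KL_eq_klDiv, EReal.coe_ennreal_add, EReal.coe_ennreal_mul, EReal.coe_ennreal_ofReal,
    max_eq_left hε.le]

/-- The pointwise integrand of the entropic functional at a density `f`. -/
def energyDensity {Z : Type*} (C : Z → ℝ) (ε : ℝ) (f : Z → ℝ≥0∞) (z : Z) : ℝ≥0∞ :=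
  f z * ENNReal.ofReal (C z) + ENNReal.ofReal ε * ENNReal.ofReal (klFun (f z).toReal)

lemma measurable_energyDensity {Z : Type*} [MeasurableSpace Z] {C : Z → ℝ} (hC : Measurable C)
    (ε : ℝ) {f : Z → ℝ≥0∞} (hf : Measurable f) : Measurable (energyDensity C ε f) := by
  unfold energyDensity
  fun_prop

lemma klDiv_withDensity {Z : Type*} [MeasurableSpace Z] (ν : Measure Z) [IsProbabilityMeasure ν]
    {f : Z → ℝ≥0∞} (hf : Measurable f) [IsProbabilityMeasure (ν.withDensity f)] :
    klDiv (ν.withDensity f) ν = ∫⁻ z, ENNReal.ofReal (klFun (f z).toReal) ∂ν := by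
  rw [klDiv_eq_lintegral_klFun_of_ac (withDensity_absolutelyContinuous ν f)]
  apply lintegral_congr_ae
  filter_upwards [Measure.rnDeriv_withDensity ν hf] with z hz
  rw [hz]

lemma Jfun_withDensity {Z : Type*} [MeasurableSpace Z] {C : Z → ℝ} (hC : Measurable C)
    (ν : Measure Z) [IsProbabilityMeasure ν] {f : Z → ℝ≥0∞} (hf : Measurable f)
    [IsProbabilityMeasure (ν.withDensity f)] {ε : ℝ} (hε : 0 < ε) :
    Jfun C ν ε (ν.withDensity f) = ((∫⁻ z, energyDensity C ε f z ∂ν : ℝ≥0∞) : EReal) := by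
  rw [Jfun_eq_coe C ν _ hε, klDiv_withDensity ν hf,
    lintegral_withDensity_eq_lintegral_mul ν hf (by fun_prop),
    ← lintegral_const_mul _ (by fun_prop), ← lintegral_add_left (by fun_prop)]
  rfl

/-- Comparing integrals of functions that agree off `D ∪ S ⁻¹' D`, by pairing the points of `D`
with their images under a measure-preserving involution `S`. -/
lemma lintegral_le_of_involution {Z : Type*} [MeasurableSpace Z] {ν : Measure Z} {S : Z → Z}
    (hS : MeasurePreserving S ν ν) (hSS : ∀ z, S (S z) = z) {D : Set Z} (hD : MeasurableSet D)
    (hdisj : Disjoint D (S ⁻¹' D)) {F G : Z → ℝ≥0∞} (hF : Measurable F) (hG : Measurable G)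
    (hout : ∀ z, z ∉ D → S z ∉ D → F z = G z)
    (hin : ∀ᵐ z ∂ν, z ∈ D → F z + F (S z) ≤ G z + G (S z)) :
    ∫⁻ z, F z ∂ν ≤ ∫⁻ z, G z ∂ν := by
  have hSD : MeasurableSet (S ⁻¹' D) := hS.measurable hD
  have key : ∀ H : Z → ℝ≥0∞, Measurable H →
      ∫⁻ z, H z ∂ν = ∫⁻ z in D, (H z + H (S z)) ∂ν + ∫⁻ z in (D ∪ S ⁻¹' D)ᶜ, H z ∂ν := by
    intro H hH
    have hpre : ∫⁻ z in S ⁻¹' D, H z ∂ν = ∫⁻ z in D, H (S z) ∂ν := by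
      have h := hS.setLIntegral_comp_preimage hD (hH.comp hS.measurable)
      simpa only [Function.comp_apply, hSS] using h
    rw [← lintegral_add_compl H (hD.union hSD), lintegral_union hSD hdisj, hpre,
      lintegral_add_left hH]
  rw [key F hF, key G hG]
  refine add_le_add (setLIntegral_mono_ae (hG.add (hG.comp hS.measurable)).aemeasurable hin)
    (le_of_eq ?_)
  refine setLIntegral_congr_fun (hD.union hSD).compl fun z hz => ?_
  simp only [mem_compl_iff, mem_union, mem_preimage, not_or] at hz
  exact hout z hz.1 hz.2

/-- The two-point Gibbs variational inequality: among pairs of nonnegative masses with a fixed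
sum, the entropic energy is minimised by masses in ratio `1 : exp (-b / ε)`. -/
lemma klFun_add_klFun_le {b ε x y : ℝ} (hε : 0 < ε) (hx : 0 ≤ x) (hy : 0 ≤ y) :
    ε * klFun ((1 + Real.exp (-b / ε))⁻¹ * (x + y)) +
        (Real.exp (-b / ε) * (1 + Real.exp (-b / ε))⁻¹ * (x + y) * b +
          ε * klFun (Real.exp (-b / ε) * (1 + Real.exp (-b / ε))⁻¹ * (x + y))) ≤
      ε * klFun x + (y * b + ε * klFun y) := by
  set q := Real.exp (-b / ε) with hq
  have hq0 : 0 < q := Real.exp_pos _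
  have hb : b = -(ε * Real.log q) := by rw [hq, Real.log_exp]; field_simp
  have gibbs : ∀ u c : ℝ, 0 ≤ u → 0 < c → u * Real.log c + u - c ≤ u * Real.log u := by
    intro u c hu hc
    rcases hu.eq_or_lt with rfl | hu
    · simpa using hc.le
    · have h1 := Real.log_le_sub_one_of_pos (div_pos hc hu)
      rw [Real.log_div hc.ne' hu.ne'] at h1
      have h2 := mul_le_mul_of_nonneg_left h1 hu.le
      have h3 : u * (c / u - 1) = c - u := by field_simp
      nlinarith
  rcases (add_nonneg hx hy).eq_or_lt with h0 | h0
  · have hx0 : x = 0 := by linarith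
    have hy0 : y = 0 := by linarith
    simp [hx0, hy0]
  · set s := x + y with hs
    have hp : 0 < (1 + q)⁻¹ := by positivity
    have g1 := gibbs x ((1 + q)⁻¹ * s) hx (by positivity)
    have g2 := gibbs y (q * (1 + q)⁻¹ * s) hy (by positivity)
    have e1 : Real.log (q * (1 + q)⁻¹ * s) = Real.log q + Real.log ((1 + q)⁻¹ * s) := by
      rw [mul_assoc, Real.log_mul hq0.ne' (by positivity)]
    rw [e1] at g2
    have hsum : (1 + q)⁻¹ * s + q * (1 + q)⁻¹ * s = s := by field_simp
    simp only [klFun_apply, e1]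
    set l := Real.log ((1 + q)⁻¹ * s)
    set u := (1 + q)⁻¹ * s
    set v := q * (1 + q)⁻¹ * s
    set lq := Real.log q
    have e2 : u * l + v * l = x * l + y * l := by
      rw [← add_mul, hsum, hs]; ring
    rw [hb]
    have : u * l + v * l + 2 - s ≤ x * Real.log x + y * Real.log y - y * lq + 2 - s := by
      linarith
    nlinarith [mul_le_mul_of_nonneg_left this hε.le]

end EntropicExchange

section SwapInvariance

open InformationTheory

lemma lintegral_eq_of_involution {Z : Type*} [MeasurableSpace Z] {ν : Measure Z} {S : Z → Z}
    (hS : MeasurePreserving S ν ν) (hSS : ∀ z, S (S z) = z) {D : Set Z} (hD : MeasurableSet D)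
    (hdisj : Disjoint D (S ⁻¹' D)) {F G : Z → ℝ≥0∞} (hF : Measurable F) (hG : Measurable G)
    (hout : ∀ z, z ∉ D → S z ∉ D → F z = G z)
    (hin : ∀ᵐ z ∂ν, z ∈ D → F z + F (S z) = G z + G (S z)) :
    ∫⁻ z, F z ∂ν = ∫⁻ z, G z ∂ν :=
  le_antisymm
    (lintegral_le_of_involution hS hSS hD hdisj hF hG hout
      (hin.mono fun _ h hz => (h hz).le))
    (lintegral_le_of_involution hS hSS hD hdisj hG hF (fun z h h' => (hout z h h').symm)
      (hin.mono fun _ h hz => (h hz).ge))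

lemma map_withDensity_eq_of_involution {Z W : Type*} [MeasurableSpace Z] [MeasurableSpace W]
    {ν : Measure Z} {S : Z → Z}
    (hS : MeasurePreserving S ν ν) (hSS : ∀ z, S (S z) = z) {D : Set Z} (hD : MeasurableSet D)
    (hdisj : Disjoint D (S ⁻¹' D)) {F G : Z → ℝ≥0∞} (hF : Measurable F) (hG : Measurable G)
    (hout : ∀ z, z ∉ D → S z ∉ D → F z = G z)
    (hin : ∀ᵐ z ∂ν, z ∈ D → F z + F (S z) = G z + G (S z))
    {p : Z → W} (hp : Measurable p) (hpS : ∀ z, p (S z) = p z) :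
    (ν.withDensity F).map p = (ν.withDensity G).map p := by
  ext B hB
  have hB' := hp hB
  rw [Measure.map_apply hp hB, Measure.map_apply hp hB, withDensity_apply _ hB',
    withDensity_apply _ hB', ← lintegral_indicator hB', ← lintegral_indicator hB']
  refine lintegral_eq_of_involution hS hSS hD hdisj (hF.indicator hB') (hG.indicator hB') ?_ ?_
  · intro z h h'
    simp only [indicator, hout z h h']
  · filter_upwards [hin] with z hz hzD
    by_cases hzB : p z ∈ B
    · simpa [indicator, hzB, hpS] using hz hzD
    · simp [indicator, hzB, hpS]

lemma map_withDensity_involution {Z : Type*} [MeasurableSpace Z] {ν : Measure Z} {S : Z → Z}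
    (hS : MeasurePreserving S ν ν) (hSS : ∀ z, S (S z) = z) {f : Z → ℝ≥0∞} (hf : Measurable f) :
    (ν.withDensity f).map S = ν.withDensity (f ∘ S) := by
  ext B hB
  have h := hS.setLIntegral_comp_preimage (hS.measurable hB) hf
  have hpre : S ⁻¹' (S ⁻¹' B) = B := by ext z; simp [hSS]
  rw [Measure.map_apply hS.measurable hB, withDensity_apply _ (hS.measurable hB),
    withDensity_apply _ hB, ← h, hpre]
  rfl

lemma isProbabilityMeasure_of_map {Z W : Type*} [MeasurableSpace Z] [MeasurableSpace W]
    {Q : Measure Z} {μ : Measure W} [hμ : IsProbabilityMeasure μ] {p : Z → W} (hp : Measurable p)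
    (h : Q.map p = μ) : IsProbabilityMeasure Q := by
  subst h
  exact ⟨by simpa [Measure.map_apply hp MeasurableSet.univ] using hμ.measure_univ⟩

variable {α : Type*} [MeasurableSpace α] {μ : Measure α} [IsProbabilityMeasure μ]
  {C : α × α → ℝ} {ε : ℝ} {P : Measure (α × α)}

lemma absolutelyContinuous_of_Jfun_ne_top (hε : 0 < ε) (hP : P ∈ couplings μ μ)
    (hfin : Jfun C (μ.prod μ) ε P ≠ ⊤) : P ≪ μ.prod μ := by
  have := hP.1
  by_contra h
  apply hfin
  rw [Jfun_eq_coe C _ _ hε, klDiv_of_not_ac h, ENNReal.mul_top (by simpa using hε), add_top,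
    EReal.coe_ennreal_top]

/-- If the cost and the marginal are invariant under a relabelling involution `T`, then so is the
density of the unique minimiser. -/
lemma rnDeriv_comp_eq_of_isMinimiser (hC : Measurable C) (hε : 0 < ε)
    (hP : P ∈ couplings μ μ) (hac : P ≪ μ.prod μ)
    (huniq : ∀ Q ∈ couplings μ μ, Jfun C (μ.prod μ) ε Q ≤ Jfun C (μ.prod μ) ε P → Q = P)
    {T : α → α} (hT : MeasurePreserving T μ μ) (hTT : ∀ x, T (T x) = x)
    (hCT : ∀ x y, C (T x, T y) = C (x, y)) :
    ∀ᵐ z ∂(μ.prod μ), P.rnDeriv (μ.prod μ) (T z.1, T z.2) = P.rnDeriv (μ.prod μ) z := by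
  have := hP.1
  set ν := μ.prod μ with hν
  set f := P.rnDeriv ν with hf
  have hfm : Measurable f := Measure.measurable_rnDeriv _ _
  have hPf : ν.withDensity f = P := Measure.withDensity_rnDeriv_eq P ν hac
  set U : α × α → α × α := Prod.map T T with hU
  have hUm : MeasurePreserving U ν ν := hT.prod hT
  have hUU : ∀ z, U (U z) = z := fun z => Prod.ext (hTT z.1) (hTT z.2)
  have hmap : P.map U = ν.withDensity (f ∘ U) := by
    rw [← hPf, map_withDensity_involution hUm hUU hfm]
  have hQ : P.map U ∈ couplings μ μ := by
    refine ⟨Measure.isProbabilityMeasure_map hUm.measurable.aemeasurable, ?_, ?_⟩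
    · rw [Measure.map_map measurable_fst hUm.measurable,
        show Prod.fst ∘ U = T ∘ Prod.fst from rfl,
        ← Measure.map_map hT.measurable measurable_fst, hP.2.1, hT.map_eq]
    · rw [Measure.map_map measurable_snd hUm.measurable,
        show Prod.snd ∘ U = T ∘ Prod.snd from rfl,
        ← Measure.map_map hT.measurable measurable_snd, hP.2.2, hT.map_eq]
  have hfU : Measurable (f ∘ U) := hfm.comp hUm.measurable
  have : IsProbabilityMeasure (ν.withDensity (f ∘ U)) := hmap ▸ hQ.1
  have : IsProbabilityMeasure (ν.withDensity f) := hPf ▸ hP.1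
  have hJ : Jfun C ν ε (P.map U) ≤ Jfun C ν ε P := by
    conv_rhs => rw [← hPf]
    rw [hmap, Jfun_withDensity hC ν hfU hε, Jfun_withDensity hC ν hfm hε,
      ← hUm.lintegral_comp (measurable_energyDensity hC ε hfm)]
    apply le_of_eq
    congr 2
    funext z
    simp only [energyDensity, Function.comp_apply]
    rw [show C (U z) = C z from hCT z.1 z.2]
  have h := huniq _ hQ hJ
  rw [hmap] at h
  conv_rhs at h => rw [← hPf]
  have hne : ∫⁻ z, (f ∘ U) z ∂ν ≠ ⊤ := by
    have h1 : ν.withDensity (f ∘ U) univ = 1 := measure_univ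
    rw [withDensity_apply _ MeasurableSet.univ, Measure.restrict_univ] at h1
    rw [h1]; exact ENNReal.one_ne_top
  exact (withDensity_eq_iff hfU.aemeasurable hfm.aemeasurable hne).1 h

/-- The exchange identity: if a relabelling involution `T` swaps `E` and `E'` and preserves both the
cost and the marginal, and the cost is `0` on the two diagonal cells and `b` on the two
off-diagonal ones, then the unique minimiser weights those cells in the ratio
`1 : exp (-b / ε)`. -/
theorem measure_offDiag_of_isMinimiser {b : ℝ} (hb : 0 ≤ b) (hC : Measurable C)
    (hε : 0 < ε) (hP : P ∈ couplings μ μ) (hfin : Jfun C (μ.prod μ) ε P ≠ ⊤)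
    (huniq : ∀ Q ∈ couplings μ μ, Jfun C (μ.prod μ) ε Q ≤ Jfun C (μ.prod μ) ε P → Q = P)
    {T : α → α} (hT : MeasurePreserving T μ μ) (hTT : ∀ x, T (T x) = x)
    (hCT : ∀ x y, C (T x, T y) = C (x, y)) {E E' : Set α} (hE : MeasurableSet E)
    (hE' : MeasurableSet E') (hEE' : Disjoint E E') (hTE : ∀ x, T x ∈ E ↔ x ∈ E')
    (hC0 : ∀ x y, (x ∈ E ∧ y ∈ E) ∨ (x ∈ E' ∧ y ∈ E') → C (x, y) = 0)
    (hCb : ∀ x y, (x ∈ E' ∧ y ∈ E) ∨ (x ∈ E ∧ y ∈ E') → C (x, y) = b) :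
    (P (E ×ˢ E')).toReal = Real.exp (-b / ε) * (P (E' ×ˢ E')).toReal := by
  have := hP.1
  have hac := absolutelyContinuous_of_Jfun_ne_top hε hP hfin
  have hsymm := rnDeriv_comp_eq_of_isMinimiser hC hε hP hac huniq hT hTT hCT
  have hTE' : ∀ x, T x ∈ E' ↔ x ∈ E := fun x => by rw [← hTE, hTT]
  have hdj : ∀ x, x ∈ E → x ∉ E' := fun x h h' => hEE'.le_bot ⟨h, h'⟩
  set ν := μ.prod μ with hν
  set f := P.rnDeriv ν with hf
  have hfm : Measurable f := Measure.measurable_rnDeriv _ _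
  have hPf : ν.withDensity f = P := Measure.withDensity_rnDeriv_eq P ν hac
  have : IsProbabilityMeasure (ν.withDensity f) := hPf ▸ hP.1
  set q := Real.exp (-b / ε) with hq
  have hq0 : 0 < q := Real.exp_pos _
  set p₀ := ENNReal.ofReal (1 + q)⁻¹ with hp₀
  set p₁ := ENNReal.ofReal (q * (1 + q)⁻¹) with hp₁
  have hp : p₀ + p₁ = 1 := by
    rw [hp₀, hp₁, ← ENNReal.ofReal_add (by positivity) (by positivity), ← ENNReal.ofReal_one]
    congr 1
    field_simp
  set S : α × α → α × α := Prod.map T id with hS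
  set S' : α × α → α × α := Prod.map id T with hS'
  have hSm : MeasurePreserving S ν ν := hT.prod (MeasurePreserving.id μ)
  have hSm' : MeasurePreserving S' ν ν := (MeasurePreserving.id μ).prod hT
  have hSS : ∀ z, S (S z) = z := fun z => Prod.ext (hTT z.1) rfl
  have hSS' : ∀ z, S' (S' z) = z := fun z => Prod.ext rfl (hTT z.2)
  have hSU : ∀ z, S (S' z) = (T z.1, T z.2) := fun z => rfl
  set D : Set (α × α) := E ×ˢ E ∪ E' ×ˢ E' with hD
  have hDm : MeasurableSet D := (hE.prod hE).union (hE'.prod hE')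
  have hmemD : ∀ z : α × α, z ∈ D ↔ (z.1 ∈ E ∧ z.2 ∈ E) ∨ (z.1 ∈ E' ∧ z.2 ∈ E') := by
    intro z; simp [hD, mem_prod]
  have hmemSD : ∀ z : α × α, S z ∈ D ↔ (z.1 ∈ E' ∧ z.2 ∈ E) ∨ (z.1 ∈ E ∧ z.2 ∈ E') := by
    intro z; simp [hmemD, hS, hTE, hTE']
  have hmemSD' : ∀ z : α × α, S' z ∈ D ↔ S z ∈ D := by
    intro z; rw [hmemSD, hmemD]; simp only [hS', Prod.map_fst, Prod.map_snd, id, hTE, hTE']; tauto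
  have hnot : ∀ z, z ∈ D → S z ∉ D := by
    intro z; rw [hmemD, hmemSD]
    have h1 := hdj z.1
    have h2 := hdj z.2
    tauto
  have hdisj : Disjoint D (S ⁻¹' D) := Set.disjoint_left.2 hnot
  have hdisj' : Disjoint D (S' ⁻¹' D) :=
    Set.disjoint_left.2 fun z hz hz' => hnot z hz ((hmemSD' z).1 hz')
  set g : α × α → ℝ≥0∞ := fun z =>
    if z ∈ D then p₀ * (f z + f (S z)) else if S z ∈ D then p₁ * (f z + f (S z)) else f z with hg
  have hfS : Measurable fun z => f (S z) := hfm.comp hSm.measurable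
  have hgm : Measurable g :=
    Measurable.ite hDm ((hfm.add hfS).const_mul _)
      (Measurable.ite (hSm.measurable hDm) ((hfm.add hfS).const_mul _) hfm)
  have hgD : ∀ z, z ∈ D → g z = p₀ * (f z + f (S z)) := fun z hz => by simp [hg, hz]
  have hgO : ∀ z, S z ∈ D → g z = p₁ * (f z + f (S z)) := fun z hz => by
    have : z ∉ D := fun h => hnot z h hz
    simp [hg, hz, this]
  have hgout : ∀ z, z ∉ D → S z ∉ D → g z = f z := fun z h h' => by simp [hg, h, h']
  have hgS : ∀ z, z ∈ D → g (S z) = p₁ * (f z + f (S z)) := fun z hz => by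
    rw [hgO (S z) (by rwa [hSS]), hSS, add_comm]
  have hsnd : (ν.withDensity g).map Prod.snd = μ := by
    rw [← hP.2.2, ← hPf]
    refine map_withDensity_eq_of_involution hSm hSS hDm hdisj hgm hfm hgout
      (Eventually.of_forall fun z hz => ?_) measurable_snd fun z => rfl
    rw [hgD z hz, hgS z hz, ← add_mul, hp, one_mul]
  have hfst : (ν.withDensity g).map Prod.fst = μ := by
    rw [← hP.2.1, ← hPf]
    refine map_withDensity_eq_of_involution hSm' hSS' hDm hdisj' hgm hfm
      (fun z h h' => hgout z h ((hmemSD' z).not.1 h')) ?_ measurable_fst fun z => rfl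
    have hsymm' := hSm.quasiMeasurePreserving.ae hsymm
    filter_upwards [hsymm, hsymm'] with z h1 h2 hz
    have h3 : f (S' z) = f (S z) := by
      rw [← h2, ← hSU, show S' (S z) = S (S' z) from rfl, hSS]
    have h4 : S (S' z) ∈ D := by
      rwa [← hmemSD', hSS']
    rw [hgD z hz, hgO (S' z) h4, hSU, h1, h3, add_comm (f (S z)), ← add_mul, hp, one_mul]
  have : IsProbabilityMeasure (ν.withDensity g) :=
    isProbabilityMeasure_of_map measurable_fst hfst
  have hJ : Jfun C ν ε (ν.withDensity g) ≤ Jfun C ν ε P := by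
    conv_rhs => rw [← hPf]
    rw [Jfun_withDensity hC ν hgm hε, Jfun_withDensity hC ν hfm hε,
      EReal.coe_ennreal_le_coe_ennreal_iff]
    refine lintegral_le_of_involution hSm hSS hDm hdisj (measurable_energyDensity hC ε hgm)
      (measurable_energyDensity hC ε hfm) (fun z h h' => ?_) ?_
    · simp only [energyDensity, hgout z h h']
    · have hlt : ∀ᵐ z ∂ν, f z < ⊤ := Measure.rnDeriv_lt_top P ν
      filter_upwards [hlt, hSm.quasiMeasurePreserving.ae hlt] with z h1 h2 hz
      have c0 : C z = 0 := hC0 z.1 z.2 ((hmemD z).1 hz)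
      have cb : C (S z) = b := by
        refine hCb (S z).1 (S z).2 ((hmemSD (S z)).1 ?_)
        rwa [hSS]
      obtain ⟨x, hx, -⟩ := ENNReal.lt_iff_exists_coe.1 h1
      obtain ⟨y, hy, -⟩ := ENNReal.lt_iff_exists_coe.1 h2
      have hx0 : (0 : ℝ) ≤ x := x.coe_nonneg
      have hy0 : (0 : ℝ) ≤ y := y.coe_nonneg
      have e0 : g z = ENNReal.ofReal ((1 + q)⁻¹ * (x + y)) := by
        rw [hgD z hz, hx, hy, hp₀, ENNReal.ofReal_mul (by positivity),
          ENNReal.ofReal_add hx0 hy0]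
        simp
      have e1 : g (S z) = ENNReal.ofReal (q * (1 + q)⁻¹ * (x + y)) := by
        rw [hgS z hz, hx, hy, hp₁, ENNReal.ofReal_mul (p := q * (1 + q)⁻¹) (by positivity),
          ENNReal.ofReal_add hx0 hy0]
        simp
      have ex : f z = ENNReal.ofReal x := by rw [hx]; simp
      have ey : f (S z) = ENNReal.ofReal y := by rw [hy]; simp
      have energy : ∀ u v : ℝ, 0 ≤ u → 0 ≤ v →
          ENNReal.ofReal u * ENNReal.ofReal 0 +
              ENNReal.ofReal ε * ENNReal.ofReal (klFun (ENNReal.ofReal u).toReal) +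
            (ENNReal.ofReal v * ENNReal.ofReal b +
              ENNReal.ofReal ε * ENNReal.ofReal (klFun (ENNReal.ofReal v).toReal)) =
          ENNReal.ofReal (ε * klFun u + (v * b + ε * klFun v)) := by
        intro u v hu hv
        have ku := mul_nonneg hε.le (klFun_nonneg hu)
        have kv := mul_nonneg hε.le (klFun_nonneg hv)
        have vb := mul_nonneg hv hb
        rw [ENNReal.toReal_ofReal hu, ENNReal.toReal_ofReal hv, ENNReal.ofReal_zero, mul_zero,
          zero_add, ENNReal.ofReal_add ku (add_nonneg vb kv), ENNReal.ofReal_add vb kv,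
          ENNReal.ofReal_mul hε.le, ENNReal.ofReal_mul hv, ENNReal.ofReal_mul hε.le]
      simp only [energyDensity, c0, cb, e0, e1, ex, ey]
      rw [energy _ _ (by positivity) (by positivity), energy _ _ hx0 hy0]
      exact ENNReal.ofReal_le_ofReal (klFun_add_klFun_le hε hx0 hy0)
  have hQP := huniq _ ⟨inferInstance, hfst, hsnd⟩ hJ
  have hR : MeasurableSet (E ×ˢ E') := hE.prod hE'
  have hpre : S ⁻¹' (E' ×ˢ E') = E ×ˢ E' := by
    ext z; simp [hS, mem_prod, hTE']
  have hcell : P (E ×ˢ E') = p₁ * (P (E ×ˢ E') + P (E' ×ˢ E')) := by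
    calc P (E ×ˢ E') = ∫⁻ z in E ×ˢ E', g z ∂ν := by
          conv_lhs => rw [← hQP]
          rw [withDensity_apply _ hR]
      _ = ∫⁻ z in E ×ˢ E', p₁ * (f z + f (S z)) ∂ν :=
          setLIntegral_congr_fun hR fun z hz => hgO z ((hmemSD z).2 (Or.inr hz))
      _ = p₁ * (∫⁻ z in E ×ˢ E', f z ∂ν + ∫⁻ z in S ⁻¹' (E' ×ˢ E'), f (S z) ∂ν) := by
          have hsum : Measurable fun z => f z + f (S z) := hfm.add hfS
          rw [lintegral_const_mul _ hsum, lintegral_add_left hfm, hpre]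
      _ = p₁ * (P (E ×ˢ E') + P (E' ×ˢ E')) := by
          rw [hSm.setLIntegral_comp_preimage (hE'.prod hE') hfm, ← withDensity_apply _ hR,
            ← withDensity_apply _ (hE'.prod hE'), hPf]
  have hreal := congrArg ENNReal.toReal hcell
  rw [ENNReal.toReal_mul, ENNReal.toReal_add (measure_ne_top _ _) (measure_ne_top _ _), hp₁,
    ENNReal.toReal_ofReal (by positivity)] at hreal
  field_simp at hreal
  linarith

end SwapInvariance

section LabelPlan

open InformationTheory

variable {α ι : Type*} [MeasurableSpace α]

/-- The density of the plan that is a product measure on each fibre of the labelling `l`. -/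
def labelDensity (μ : Measure α) (l : α → ι) (z : α × α) : ℝ≥0∞ :=
  if l z.2 = l z.1 then (μ (l ⁻¹' {l z.1}))⁻¹ else 0

lemma ae_measure_fibre_ne_zero [Countable ι] (μ : Measure α) (l : α → ι) :
    ∀ᵐ x ∂μ, μ (l ⁻¹' {l x}) ≠ 0 := by
  have h : ∀ᵐ x ∂μ, ∀ p : ι, μ (l ⁻¹' {p}) = 0 → l x ≠ p := by
    rw [ae_all_iff]
    intro p
    by_cases hp : μ (l ⁻¹' {p}) = 0
    · have := measure_eq_zero_iff_ae_notMem.1 hp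
      filter_upwards [this] with x hx _
      simpa using hx
    · exact Eventually.of_forall fun x h => absurd h hp
  filter_upwards [h] with x hx h0
  exact hx _ h0 rfl

variable [MeasurableSpace ι] [MeasurableSingletonClass ι]

lemma measurable_labelDensity [Countable ι] (μ : Measure α) {l : α → ι} (hl : Measurable l) :
    Measurable (labelDensity μ l) := by
  have h : Measurable fun p : ι × ι => if p.2 = p.1 then (μ (l ⁻¹' {p.1}))⁻¹ else 0 :=
    Measurable.of_discrete
  exact h.comp ((hl.comp measurable_fst).prodMk (hl.comp measurable_snd))

lemma lintegral_labelDensity_mul (μ : Measure α) {l : α → ι} (hl : Measurable l)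
    (F : ℝ≥0∞ → ℝ≥0∞) (x : α) :
    ∫⁻ y, labelDensity μ l (x, y) * F (labelDensity μ l (x, y)) ∂μ =
      (μ (l ⁻¹' {l x}))⁻¹ * F (μ (l ⁻¹' {l x}))⁻¹ * μ (l ⁻¹' {l x}) := by
  have h : ∀ y, labelDensity μ l (x, y) * F (labelDensity μ l (x, y)) =
      (l ⁻¹' {l x}).indicator (fun _ => (μ (l ⁻¹' {l x}))⁻¹ * F (μ (l ⁻¹' {l x}))⁻¹) y := by
    intro y
    by_cases hy : l y = l x <;> simp [labelDensity, indicator, hy]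
  simp_rw [h]
  rw [lintegral_indicator (hl (measurableSet_singleton _)), setLIntegral_const]

lemma labelPlan_mem_couplings [Countable ι] (μ : Measure α) [IsProbabilityMeasure μ]
    {l : α → ι} (hl : Measurable l) :
    (μ.prod μ).withDensity (labelDensity μ l) ∈ couplings μ μ := by
  have hm := measurable_labelDensity μ hl
  have hfst : ((μ.prod μ).withDensity (labelDensity μ l)).map Prod.fst = μ := by
    ext B hB
    have hB' : MeasurableSet (Prod.fst ⁻¹' B : Set (α × α)) := measurable_fst hB
    rw [Measure.map_apply measurable_fst hB, withDensity_apply _ hB', ← lintegral_indicator hB',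
      lintegral_prod _ (hm.indicator hB').aemeasurable, ← lintegral_indicator_one hB]
    apply lintegral_congr_ae
    filter_upwards [ae_measure_fibre_ne_zero μ l] with x hx
    have h1 : ∫⁻ y, labelDensity μ l (x, y) ∂μ = 1 := by
      have h := lintegral_labelDensity_mul μ hl (fun _ => 1) x
      simp only [mul_one] at h
      rw [h, ENNReal.inv_mul_cancel hx (measure_ne_top _ _)]
    by_cases hxB : x ∈ B <;> simp [indicator, hxB, h1]
  have hswap : ((μ.prod μ).withDensity (labelDensity μ l)).map Prod.swap =
      (μ.prod μ).withDensity (labelDensity μ l) := by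
    rw [map_withDensity_involution Measure.measurePreserving_swap Prod.swap_swap hm]
    congr 1
    funext z
    by_cases h : l z.1 = l z.2
    · simp [labelDensity, h]
    · simp [labelDensity, h, Ne.symm h]
  refine ⟨isProbabilityMeasure_of_map measurable_fst hfst, hfst, ?_⟩
  rw [← hswap, Measure.map_map measurable_snd measurable_swap,
    show Prod.snd ∘ (Prod.swap : α × α → α × α) = Prod.fst from rfl, hfst]

/-- The functional at the fibrewise product plan is at most `ε` times one plus the Shannon entropy
of the labelling, for every cost that vanishes on pairs of equally labelled points. -/
lemma Jfun_labelPlan_le [Countable ι] (μ : Measure α) [IsProbabilityMeasure μ]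
    {l : α → ι} (hl : Measurable l) {C : α × α → ℝ} (hC : Measurable C)
    (hC0 : ∀ z : α × α, l z.2 = l z.1 → C z = 0) {ε : ℝ} (hε : 0 < ε) :
    Jfun C (μ.prod μ) ε ((μ.prod μ).withDensity (labelDensity μ l)) ≤
      ((ENNReal.ofReal ε *
        (∫⁻ x, ENNReal.ofReal (Real.log (μ (l ⁻¹' {l x}))⁻¹.toReal) ∂μ + 1) : ℝ≥0∞) : EReal) := by
  have hm := measurable_labelDensity μ hl
  have := (labelPlan_mem_couplings μ hl).1
  rw [Jfun_withDensity hC _ hm hε, EReal.coe_ennreal_le_coe_ennreal_iff]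
  set d := labelDensity μ l with hd
  set F : ℝ≥0∞ → ℝ≥0∞ := fun t => ENNReal.ofReal (Real.log t.toReal) with hF
  have hFm : Measurable F := by fun_prop
  have hpt : ∀ z, energyDensity C ε d z ≤ ENNReal.ofReal ε * (d z * F (d z) + 1) := by
    intro z
    have h0 : d z * ENNReal.ofReal (C z) = 0 := by
      by_cases h : l z.2 = l z.1
      · simp [hC0 z h]
      · simp [hd, labelDensity, h]
    rw [energyDensity, h0, zero_add]
    gcongr
    calc ENNReal.ofReal (klFun (d z).toReal)
        ≤ ENNReal.ofReal ((d z).toReal * Real.log (d z).toReal + 1) := by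
          apply ENNReal.ofReal_le_ofReal
          rw [klFun_apply]
          linarith [ENNReal.toReal_nonneg (a := d z)]
      _ ≤ ENNReal.ofReal ((d z).toReal * Real.log (d z).toReal) + ENNReal.ofReal 1 :=
          ENNReal.ofReal_add_le
      _ ≤ d z * F (d z) + 1 := by
          rw [ENNReal.ofReal_mul ENNReal.toReal_nonneg, ENNReal.ofReal_one]
          gcongr
          exact ENNReal.ofReal_toReal_le
  calc ∫⁻ z, energyDensity C ε d z ∂(μ.prod μ)
      ≤ ∫⁻ z, ENNReal.ofReal ε * (d z * F (d z) + 1) ∂(μ.prod μ) := lintegral_mono hpt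
    _ = ENNReal.ofReal ε * (∫⁻ x, ∫⁻ y, d (x, y) * F (d (x, y)) ∂μ ∂μ + 1) := by
        rw [lintegral_const_mul _ (by fun_prop), lintegral_add_right _ (by fun_prop),
          lintegral_prod _ (by fun_prop)]
        simp
    _ ≤ _ := by
        gcongr with x
        rw [lintegral_labelDensity_mul μ hl F x, mul_right_comm]
        exact mul_le_of_le_one_left' (ENNReal.inv_mul_le_one _)

end LabelPlan

section BlockModel

lemma Mseq_succ (κ : ℝ) {n : ℕ} (hn : 1 ≤ n) :
    Mseq κ (n + 1) = Mseq κ n + 3 * ((mseq κ n : ℝ) + 1) := by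
  obtain ⟨k, rfl⟩ := Nat.exists_eq_add_of_le' hn
  rfl

lemma Mseq_add_le (κ : ℝ) {n m : ℕ} (hn : 1 ≤ n) (hnm : n < m) :
    Mseq κ n + 3 * ((mseq κ n : ℝ) + 1) ≤ Mseq κ m := by
  induction m, hnm using Nat.le_induction with
  | base => exact (Mseq_succ κ hn).ge
  | succ m hm ih =>
    rw [Mseq_succ κ (by omega)]
    have : (0 : ℝ) ≤ mseq κ m := Nat.cast_nonneg _
    linarith

/-- The left endpoint of the interval with label `p`. -/
def leftEnd (κ : ℝ) (p : ℕ × ℕ) : ℝ := Mseq κ p.1 + 3 * p.2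

lemma Iab_eq (κ : ℝ) (p : ℕ × ℕ) : Iab κ p.1 p.2 = Icc (leftEnd κ p) (leftEnd κ p + 1) := rfl

lemma leftEnd_separated {κ : ℝ} {p q : ℕ × ℕ} (hp : validLabel κ p) (hq : validLabel κ q)
    (hpq : p ≠ q) : leftEnd κ p + 3 ≤ leftEnd κ q ∨ leftEnd κ q + 3 ≤ leftEnd κ p := by
  have key : ∀ r s : ℕ × ℕ, validLabel κ r → r.1 < s.1 → leftEnd κ r + 3 ≤ leftEnd κ s := by
    intro r s hr hrs
    have h1 := Mseq_add_le κ hr.1 hrs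
    have h2 : (r.2 : ℝ) ≤ mseq κ r.1 := by exact_mod_cast hr.2
    have h3 : (0 : ℝ) ≤ s.2 := Nat.cast_nonneg _
    unfold leftEnd
    linarith
  have key' : ∀ r s : ℕ × ℕ, r.1 = s.1 → r.2 < s.2 → leftEnd κ r + 3 ≤ leftEnd κ s := by
    intro r s hrs h
    have h1 : (r.2 : ℝ) + 1 ≤ s.2 := by exact_mod_cast h
    unfold leftEnd
    rw [hrs]
    linarith
  rcases lt_trichotomy p.1 q.1 with h | h | h
  · exact Or.inl (key p q hp h)
  · rcases lt_trichotomy p.2 q.2 with h' | h' | h'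
    · exact Or.inl (key' p q h h')
    · exact absurd (Prod.ext h h') hpq
    · exact Or.inr (key' q p h.symm h')
  · exact Or.inr (key q p hq h)

lemma label_unique {κ : ℝ} {p q : ℕ × ℕ} (hp : validLabel κ p) (hq : validLabel κ q) {x : ℝ}
    (hxp : x ∈ Iab κ p.1 p.2) (hxq : x ∈ Iab κ q.1 q.2) : p = q := by
  by_contra hpq
  rw [Iab_eq, mem_Icc] at hxp hxq
  rcases leftEnd_separated hp hq hpq with h | h <;> linarith [hxp.1, hxp.2, hxq.1, hxq.2]

lemma labl_eq {κ : ℝ} {p : ℕ × ℕ} (hp : validLabel κ p) {x : ℝ} (hx : x ∈ Iab κ p.1 p.2) :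
    labl κ x = p := by
  have h : ∃ p : ℕ × ℕ, validLabel κ p ∧ x ∈ Iab κ p.1 p.2 := ⟨p, hp, hx⟩
  rw [labl, dif_pos h]
  exact label_unique h.choose_spec.1 hp h.choose_spec.2 hx

lemma labl_cases (κ x : ℝ) :
    (validLabel κ (labl κ x) ∧ x ∈ Iab κ (labl κ x).1 (labl κ x).2) ∨ labl κ x = (0, 0) := by
  by_cases h : ∃ p : ℕ × ℕ, validLabel κ p ∧ x ∈ Iab κ p.1 p.2
  · left
    obtain ⟨p, hp, hx⟩ := h
    rw [labl_eq hp hx]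
    exact ⟨hp, hx⟩
  · right
    rw [labl, dif_neg h]

lemma not_validLabel_zero (κ : ℝ) : ¬ validLabel κ (0, 0) := fun h => by
  simpa using h.1

lemma preimage_labl {κ : ℝ} {p : ℕ × ℕ} (hp : validLabel κ p) :
    labl κ ⁻¹' {p} = Iab κ p.1 p.2 := by
  ext x
  refine ⟨fun hx => ?_, fun hx => labl_eq hp hx⟩
  rcases labl_cases κ x with h | h
  · rw [show labl κ x = p from hx] at h
    exact h.2
  · rw [show labl κ x = p from hx] at h
    exact absurd (h ▸ hp) (not_validLabel_zero κ)

lemma measurableSet_Iab (κ : ℝ) (n i : ℕ) : MeasurableSet (Iab κ n i) := measurableSet_Icc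

lemma measurable_labl (κ : ℝ) : Measurable (labl κ) := by
  have hvalid : ∀ p, validLabel κ p → MeasurableSet (labl κ ⁻¹' {p}) := fun p hp => by
    rw [preimage_labl hp]
    exact measurableSet_Iab κ _ _
  refine measurable_to_countable' fun p => ?_
  by_cases hp : validLabel κ p
  · exact hvalid p hp
  by_cases h0 : p = (0, 0)
  · have : labl κ ⁻¹' {p} = (⋃ q ∈ {q | validLabel κ q}, labl κ ⁻¹' {q})ᶜ := by
      ext x
      simp only [mem_preimage, mem_singleton_iff, mem_compl_iff, mem_iUnion, mem_ofPred_eq,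
        exists_prop, not_exists, not_and, h0]
      constructor
      · rintro h q hq rfl
        exact not_validLabel_zero κ (h ▸ hq)
      · intro h
        rcases labl_cases κ x with h' | h'
        · exact absurd rfl (h _ h'.1)
        · exact h'
    rw [this]
    exact (MeasurableSet.biUnion (to_countable _) hvalid).compl
  · have : labl κ ⁻¹' {p} = ∅ := by
      ext x
      simp only [mem_preimage, mem_singleton_iff, mem_empty_iff_false, iff_false]
      rintro rfl
      rcases labl_cases κ x with h | h
      · exact hp h.1
      · exact h0 h
    rw [this]
    exact MeasurableSet.empty

lemma measurable_Ccont (a b κ : ℝ) : Measurable (Ccont a b κ) := by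
  have h : Measurable fun p : (ℕ × ℕ) × (ℕ × ℕ) => CdPair a b p.1 p.2 := Measurable.of_discrete
  exact h.comp (((measurable_labl κ).comp measurable_fst).prodMk
    ((measurable_labl κ).comp measurable_snd))

/-- The mass that `muC` gives to the interval with label `p`. -/
def labelMass (κ : ℝ) (p : ℕ × ℕ) : ℝ≥0∞ :=
  if validLabel κ p then ENNReal.ofReal (wseq p.1 / ((mseq κ p.1 : ℝ) + 1)) else 0

lemma muC_eq_sum (κ : ℝ) :
    muC κ = Measure.sum fun p : ℕ × ℕ => labelMass κ p • lam κ p.1 p.2 := by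
  unfold muC labelMass
  congr 1
  funext p
  split_ifs <;> simp

lemma lam_Iab_self (κ : ℝ) (p : ℕ × ℕ) : lam κ p.1 p.2 (Iab κ p.1 p.2) = 1 := by
  rw [lam, Measure.restrict_apply_self, Iab_eq, Real.volume_Icc]
  simp

lemma muC_Iab {κ : ℝ} {p : ℕ × ℕ} (hp : validLabel κ p) :
    muC κ (Iab κ p.1 p.2) = labelMass κ p := by
  have hm := measurableSet_Iab κ p.1 p.2
  rw [muC_eq_sum, Measure.sum_apply _ hm, tsum_eq_single p]
  · rw [Measure.smul_apply, lam_Iab_self, smul_eq_mul, mul_one]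
  · intro q hq
    by_cases hv : validLabel κ q
    · have : lam κ q.1 q.2 (Iab κ p.1 p.2) = 0 := by
        rw [lam, Measure.restrict_apply hm]
        convert! measure_empty (μ := (volume : Measure ℝ))
        ext x
        simp only [mem_inter_iff, mem_empty_iff_false, iff_false]
        exact fun h => hq (label_unique hv hp h.2 h.1)
      simp [this]
    · simp [labelMass, hv]

lemma lintegral_comp_labl (κ : ℝ) (G : ℕ × ℕ → ℝ≥0∞) :
    ∫⁻ x, G (labl κ x) ∂(muC κ) = ∑' p, labelMass κ p * G p := by
  rw [muC_eq_sum, lintegral_sum_measure]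
  congr 1
  funext p
  rw [lintegral_smul_measure, smul_eq_mul]
  by_cases hp : validLabel κ p
  · congr 1
    have : ∫⁻ x, G (labl κ x) ∂(lam κ p.1 p.2) = ∫⁻ _, G p ∂(lam κ p.1 p.2) :=
      setLIntegral_congr_fun (measurableSet_Iab κ _ _) fun x hx => by
        simp only [labl_eq hp hx]
    rw [this, lintegral_const, lam, Measure.restrict_apply_univ, Iab_eq, Real.volume_Icc]
    simp
  · simp [labelMass, hp]

/-- The map translating each interval onto the interval whose label is given by `σ`. -/
def permuteBlocks (κ : ℝ) (σ : ℕ × ℕ → ℕ × ℕ) (x : ℝ) : ℝ :=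
  x + (leftEnd κ (σ (labl κ x)) - leftEnd κ (labl κ x))

lemma measurable_permuteBlocks (κ : ℝ) (σ : ℕ × ℕ → ℕ × ℕ) : Measurable (permuteBlocks κ σ) := by
  have h : Measurable fun p : ℕ × ℕ => leftEnd κ (σ p) - leftEnd κ p := Measurable.of_discrete
  exact measurable_id.add (h.comp (measurable_labl κ))

lemma labl_permuteBlocks {κ : ℝ} {σ : ℕ × ℕ → ℕ × ℕ} (hσ : ∀ p, validLabel κ p → validLabel κ (σ p))
    (h0 : σ (0, 0) = (0, 0)) (x : ℝ) : labl κ (permuteBlocks κ σ x) = σ (labl κ x) := by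
  rcases labl_cases κ x with h | h
  · apply labl_eq (hσ _ h.1)
    have hx := h.2
    rw [Iab_eq, mem_Icc] at hx ⊢
    unfold permuteBlocks
    constructor <;> linarith [hx.1, hx.2]
  · have : permuteBlocks κ σ x = x := by simp [permuteBlocks, h, h0]
    rw [this, h, h0]

lemma permuteBlocks_permuteBlocks {κ : ℝ} {σ : ℕ × ℕ → ℕ × ℕ}
    (hσ : ∀ p, validLabel κ p → validLabel κ (σ p)) (h0 : σ (0, 0) = (0, 0))
    (hσσ : ∀ p, σ (σ p) = p) (x : ℝ) : permuteBlocks κ σ (permuteBlocks κ σ x) = x := by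
  have h := labl_permuteBlocks hσ h0 x
  rw [permuteBlocks, h, hσσ, permuteBlocks]
  ring

lemma map_permuteBlocks_lam {κ : ℝ} (σ : ℕ × ℕ → ℕ × ℕ) {p : ℕ × ℕ} (hp : validLabel κ p) :
    (lam κ p.1 p.2).map (permuteBlocks κ σ) = lam κ (σ p).1 (σ p).2 := by
  set d := leftEnd κ (σ p) - leftEnd κ p with hd
  have h1 : permuteBlocks κ σ =ᵐ[lam κ p.1 p.2] fun x => x + d := by
    filter_upwards [ae_restrict_mem (measurableSet_Iab κ p.1 p.2)] with x hx
    simp only [permuteBlocks, labl_eq hp hx, hd]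
  have h2 := ((measurePreserving_add_right (volume : Measure ℝ) d).restrict_preimage
    (measurableSet_Iab κ (σ p).1 (σ p).2)).map_eq
  have h3 : (fun x => x + d) ⁻¹' Iab κ (σ p).1 (σ p).2 = Iab κ p.1 p.2 := by
    rw [Iab_eq, Iab_eq, preimage_add_const_Icc, hd]
    congr 1 <;> ring
  rw [Measure.map_congr h1, lam, lam, ← h2, h3]

lemma measurePreserving_permuteBlocks {κ : ℝ} (σ : Equiv.Perm (ℕ × ℕ))
    (hσ : ∀ p, labelMass κ (σ p) = labelMass κ p) :
    MeasurePreserving (permuteBlocks κ σ) (muC κ) (muC κ) := by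
  have hm := measurable_permuteBlocks κ σ
  refine ⟨hm, ?_⟩
  conv_rhs => rw [muC_eq_sum, ← Measure.sum_comp_equiv σ]
  rw [muC_eq_sum, Measure.map_sum hm.aemeasurable]
  congr 1
  funext p
  rw [Measure.map_smul, Function.comp_apply, hσ]
  by_cases hp : validLabel κ p
  · rw [map_permuteBlocks_lam σ hp]
  · simp [labelMass, hp]

lemma CdPair_swap (a b : ℝ) {N i j : ℕ} (hi : 1 ≤ i) (hj : 1 ≤ j) (p q : ℕ × ℕ) :
    CdPair a b (Equiv.swap (N, i) (N, j) p) (Equiv.swap (N, i) (N, j) q) = CdPair a b p q := by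
  have h1 : ∀ r : ℕ × ℕ, (Equiv.swap (N, i) (N, j) r).1 = r.1 := by
    intro r
    rw [Equiv.swap_apply_def]
    split_ifs with h h' <;> simp [*]
  have h2 : ∀ r : ℕ × ℕ, (Equiv.swap (N, i) (N, j) r).2 = 0 ↔ r.2 = 0 := by
    intro r
    rw [Equiv.swap_apply_def]
    split_ifs with h h'
    · subst h; simp; omega
    · subst h'; simp; omega
    · rfl
  have h3 : p.1 = q.1 → ((Equiv.swap (N, i) (N, j) p).2 = (Equiv.swap (N, i) (N, j) q).2 ↔
      p.2 = q.2) := by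
    intro h
    constructor
    · intro h'
      have : Equiv.swap (N, i) (N, j) p = Equiv.swap (N, i) (N, j) q :=
        Prod.ext (by rw [h1, h1, h]) h'
      rw [(Equiv.swap (N, i) (N, j)).injective this]
    · intro h'
      rw [Prod.ext h h']
  unfold CdPair
  simp only [h1, h2]
  by_cases h : p.1 = q.1
  · simp only [h3 h]
  · simp [h]

lemma isClopen_preimage_Iab {κ : ℝ} {p : ℕ × ℕ} (hp : validLabel κ p) :
    IsClopen {x : Xset κ | (x : ℝ) ∈ Iab κ p.1 p.2} := by
  refine ⟨isClosed_Icc.preimage continuous_subtype_val, ?_⟩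
  have : {x : Xset κ | (x : ℝ) ∈ Iab κ p.1 p.2} =
      Subtype.val ⁻¹' Ioo (leftEnd κ p - 1) (leftEnd κ p + 2) := by
    ext ⟨x, hx⟩
    simp only [Xset, mem_iUnion, exists_prop] at hx
    obtain ⟨n, hn, i, hi, hx⟩ := hx
    simp only [Iab_eq, mem_ofPred_eq, mem_preimage, mem_Icc, mem_Ioo]
    constructor
    · rintro ⟨h1, h2⟩
      constructor <;> linarith
    · rintro ⟨h1, h2⟩
      have hq : validLabel κ (n, i) := ⟨hn, hi⟩
      by_cases hpq : p = (n, i)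
      · rw [hpq]; exact hx
      · have hx' : x ∈ Icc (leftEnd κ (n, i)) (leftEnd κ (n, i) + 1) := hx
        rw [mem_Icc] at hx'
        rcases leftEnd_separated hp hq hpq with h | h <;> linarith [hx'.1, hx'.2]
  rw [this]
  exact isOpen_Ioo.preimage continuous_subtype_val

end BlockModel

section BlockEntropy

lemma summable_inv_succ_pow_three : Summable fun k : ℕ => (((k : ℝ) + 1) ^ 3)⁻¹ := by
  have h : Summable fun k : ℕ => ((k : ℝ) ^ 3)⁻¹ := Real.summable_nat_pow_inv.2 (by norm_num)
  simpa using (summable_nat_add_iff 1).2 h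

lemma zeta3_pos : 0 < zeta3 :=
  summable_inv_succ_pow_three.tsum_pos (fun _ => by positivity) 0 (by norm_num)

lemma wseq_pos {n : ℕ} (hn : 1 ≤ n) : 0 < wseq n := by
  have := zeta3_pos
  have : (0 : ℝ) < n := by exact_mod_cast hn
  unfold wseq
  positivity

lemma wseq_nonneg (n : ℕ) : 0 ≤ wseq n := by
  have := zeta3_pos
  unfold wseq
  positivity

lemma summable_wseq_mul : Summable fun n : ℕ => wseq n * n := by
  have h : Summable fun n : ℕ => (1 / zeta3) * ((n : ℝ) ^ 2)⁻¹ :=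
    (Real.summable_nat_pow_inv.2 (by norm_num)).mul_left _
  refine h.congr fun n => ?_
  rcases Nat.eq_zero_or_pos n with rfl | hn
  · simp
  · have : (0 : ℝ) < n := by exact_mod_cast hn
    unfold wseq
    field_simp

lemma labelMass_pos {κ : ℝ} {p : ℕ × ℕ} (hp : validLabel κ p) : 0 < labelMass κ p := by
  rw [labelMass, if_pos hp, ENNReal.ofReal_pos]
  have := wseq_pos hp.1
  positivity

lemma mseq_add_one_le {κ : ℝ} (hκ : 0 ≤ κ) (n : ℕ) :
    (mseq κ n : ℝ) + 1 ≤ 3 * Real.exp (κ * n) := by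
  have h1 : 1 ≤ Real.exp (κ * n) := Real.one_le_exp (by positivity)
  have h2 : (⌊Real.exp (κ * n)⌋₊ : ℝ) ≤ Real.exp (κ * n) := Nat.floor_le (by positivity)
  unfold mseq
  push_cast
  rcases max_cases (2 : ℝ) (⌊Real.exp (κ * n)⌋₊ : ℝ) with h | h <;> linarith [h.1]

lemma log_inv_mass_le {κ : ℝ} (hκ : 0 ≤ κ) {n : ℕ} (hn : 1 ≤ n) :
    Real.log (wseq n / ((mseq κ n : ℝ) + 1))⁻¹ ≤ (|Real.log (3 * zeta3)| + κ + 3) * n := by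
  have hz := zeta3_pos
  have hn1 : (1 : ℝ) ≤ n := by exact_mod_cast hn
  have hn0 : (0 : ℝ) < n := by linarith
  have hw := wseq_pos hn
  have h1 : (wseq n / ((mseq κ n : ℝ) + 1))⁻¹ ≤ 3 * zeta3 * (Real.exp (κ * n) * (n : ℝ) ^ 3) := by
    have e : (wseq n / ((mseq κ n : ℝ) + 1))⁻¹ =
        ((mseq κ n : ℝ) + 1) * (zeta3 * (n : ℝ) ^ 3) := by
      unfold wseq
      field_simp
    rw [e]
    calc ((mseq κ n : ℝ) + 1) * (zeta3 * (n : ℝ) ^ 3)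
        ≤ (3 * Real.exp (κ * n)) * (zeta3 * (n : ℝ) ^ 3) := by
          gcongr
          exact mseq_add_one_le hκ n
      _ = _ := by ring
  have h2 := Real.log_le_log (by positivity) h1
  rw [Real.log_mul (x := 3 * zeta3) (by positivity) (by positivity),
    Real.log_mul (x := Real.exp (κ * n)) (by positivity) (by positivity),
    Real.log_exp, Real.log_pow] at h2
  have h3 : Real.log n ≤ n := (Real.log_le_sub_one_of_pos hn0).trans (by linarith)
  have h4 := le_abs_self (Real.log (3 * zeta3))
  have h5 : |Real.log (3 * zeta3)| ≤ |Real.log (3 * zeta3)| * n :=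
    le_mul_of_one_le_right (abs_nonneg _) hn1
  push_cast at h2
  linarith

/-- The labelling of the block model has finite Shannon entropy. -/
lemma labelEntropy_ne_top {κ : ℝ} (hκ : 0 ≤ κ) :
    ∫⁻ x, ENNReal.ofReal (Real.log (muC κ (labl κ ⁻¹' {labl κ x}))⁻¹.toReal) ∂(muC κ) ≠ ⊤ := by
  rw [lintegral_comp_labl κ
    (fun p => ENNReal.ofReal (Real.log (muC κ (labl κ ⁻¹' {p}))⁻¹.toReal))]
  set A : ℝ := |Real.log (3 * zeta3)| + κ + 3 with hA
  have hA0 : 0 ≤ A := by positivity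
  have hterm : ∀ n i, labelMass κ (n, i) *
      ENNReal.ofReal (Real.log (muC κ (labl κ ⁻¹' {(n, i)}))⁻¹.toReal) ≤
      if i ∈ Finset.range (mseq κ n + 1) then
        ENNReal.ofReal (wseq n * (A * n) / ((mseq κ n : ℝ) + 1)) else 0 := by
    intro n i
    by_cases hv : validLabel κ (n, i)
    · have hw := wseq_pos hv.1
      have hi : i ∈ Finset.range (mseq κ n + 1) := Finset.mem_range_succ_iff.2 hv.2
      have hw0 : 0 < wseq n / ((mseq κ n : ℝ) + 1) := by positivity
      rw [preimage_labl hv, muC_Iab hv, labelMass, if_pos hv, if_pos hi,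
        ← ENNReal.ofReal_inv_of_pos hw0, ENNReal.toReal_ofReal (by positivity),
        ← ENNReal.ofReal_mul hw0.le]
      apply ENNReal.ofReal_le_ofReal
      rw [mul_div_right_comm]
      gcongr
      exact log_inv_mass_le hκ hv.1
    · simp [labelMass, hv]
  have hsum : ∀ n, ∑' i, labelMass κ (n, i) *
      ENNReal.ofReal (Real.log (muC κ (labl κ ⁻¹' {(n, i)}))⁻¹.toReal) ≤
      ENNReal.ofReal (A * (wseq n * n)) := by
    intro n
    refine (ENNReal.tsum_le_tsum (hterm n)).trans ?_
    have hw := wseq_nonneg n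
    rw [tsum_eq_sum (s := Finset.range (mseq κ n + 1)) fun i hi => if_neg hi,
      Finset.sum_congr rfl fun i hi => if_pos hi, Finset.sum_const, Finset.card_range,
      ← ENNReal.ofReal_nsmul]
    apply le_of_eq
    congr 1
    rw [nsmul_eq_mul]
    push_cast
    field_simp
  rw [ENNReal.tsum_prod' (f := fun p => labelMass κ p *
    ENNReal.ofReal (Real.log (muC κ (labl κ ⁻¹' {p}))⁻¹.toReal))]
  refine ne_top_of_le_ne_top ?_ (ENNReal.tsum_le_tsum hsum)
  exact (summable_wseq_mul.mul_left A).tsum_ofReal_ne_top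

end BlockEntropy

section RectangleDecay

lemma min_le_Ccont {a b : ℝ} (κ : ℝ) (hab : a ≤ b) {N j : ℕ} (hN : 1 ≤ N)
    {x y : ℝ} (hx : labl κ x = (N, j)) (hy : labl κ y ≠ (N, j)) :
    min a 1 ≤ Ccont a b κ (x, y) := by
  have hy' : N = (labl κ y).1 → j ≠ (labl κ y).2 := fun h1 h2 => hy (Prod.ext h1.symm h2.symm)
  have hL : (1 : ℝ) ≤ Lseq N := by
    exact_mod_cast Nat.one_le_pow 4 N hN
  have hL' : (0 : ℝ) ≤ Lseq (labl κ y).1 := Nat.cast_nonneg _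
  simp only [Ccont, hx, CdPair]
  split_ifs with h1 h2 h3
  · exact absurd h2 (hy' h1)
  · exact min_le_left _ _
  · exact (min_le_left _ _).trans hab
  · exact (min_le_right _ _).trans (by linarith)

/-- A coupling carries onto a diagonal cell all of the mass of that cell, up to its total cost. -/
lemma labelMass_le_add_cost {a b κ : ℝ} (ha : 0 < a) (hab : a ≤ b) {N j : ℕ}
    (hv : validLabel κ (N, j)) {P : Measure (ℝ × ℝ)} (hP : P ∈ couplings (muC κ) (muC κ)) :
    labelMass κ (N, j) ≤ P (Iab κ N j ×ˢ Iab κ N j) +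
      (∫⁻ z, ENNReal.ofReal (Ccont a b κ z) ∂P) / ENNReal.ofReal (min a 1) := by
  have hc : 0 < min a 1 := lt_min ha one_pos
  have hm := measurable_Ccont a b κ
  rw [← muC_Iab hv]
  conv_lhs => rw [← hP.2.1]
  rw [Measure.map_apply measurable_fst (measurableSet_Iab κ N j)]
  refine (measure_mono (t := Iab κ N j ×ˢ Iab κ N j ∪
    {z | ENNReal.ofReal (min a 1) ≤ ENNReal.ofReal (Ccont a b κ z)}) ?_).trans
    ((measure_union_le _ _).trans (add_le_add le_rfl ?_))
  · rintro ⟨x, y⟩ hx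
    by_cases hy : y ∈ Iab κ N j
    · exact Or.inl ⟨hx, hy⟩
    · right
      apply ENNReal.ofReal_le_ofReal
      refine min_le_Ccont κ hab hv.1 (labl_eq hv hx) fun h => hy ?_
      have : y ∈ labl κ ⁻¹' {(N, j)} := h
      rwa [preimage_labl hv] at this
  · exact meas_ge_le_lintegral_div (by fun_prop) (by simpa using ha) ENNReal.ofReal_ne_top

end RectangleDecay

lemma Ccont_eq_zero (a b κ : ℝ) {z : ℝ × ℝ} (h : labl κ z.2 = labl κ z.1) :
    Ccont a b κ z = 0 := by
  simp [Ccont, CdPair, h]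

/-- The optimal value is at most `ε` times a constant independent of `ε`. -/
lemma exists_Jfun_le (a b : ℝ) {κ : ℝ} (hκ : 0 ≤ κ) [IsProbabilityMeasure (muC κ)] :
    ∃ K : ℝ≥0∞, K ≠ ⊤ ∧ ∀ ε : ℝ, 0 < ε → ∃ Q ∈ couplings (muC κ) (muC κ),
      Jfun (Ccont a b κ) ((muC κ).prod (muC κ)) ε Q ≤ ((ENNReal.ofReal ε * K : ℝ≥0∞) : EReal) :=
  ⟨_, ENNReal.add_ne_top.2 ⟨labelEntropy_ne_top hκ, ENNReal.one_ne_top⟩, fun _ hε =>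
    ⟨_, labelPlan_mem_couplings (muC κ) (measurable_labl κ),
      Jfun_labelPlan_le (muC κ) (measurable_labl κ) (measurable_Ccont a b κ)
        (fun _ => Ccont_eq_zero a b κ) hε⟩⟩

lemma measure_rectangle_of_isMinimiser {a b κ : ℝ} (hb : 0 ≤ b) {ε : ℝ} (hε : 0 < ε)
    [IsProbabilityMeasure (muC κ)] {P : Measure (ℝ × ℝ)} (hP : P ∈ couplings (muC κ) (muC κ))
    (hfin : Jfun (Ccont a b κ) ((muC κ).prod (muC κ)) ε P ≠ ⊤)
    (huniq : ∀ Q ∈ couplings (muC κ) (muC κ), Jfun (Ccont a b κ) ((muC κ).prod (muC κ)) ε Q ≤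
      Jfun (Ccont a b κ) ((muC κ).prod (muC κ)) ε P → Q = P)
    {N i j : ℕ} (hi1 : 1 ≤ i) (hj1 : 1 ≤ j) (hvi : validLabel κ (N, i))
    (hvj : validLabel κ (N, j)) (hij : i ≠ j) :
    (P (Iab κ N i ×ˢ Iab κ N j)).toReal =
      Real.exp (-b / ε) * (P (Iab κ N j ×ˢ Iab κ N j)).toReal := by
  set σ : Equiv.Perm (ℕ × ℕ) := Equiv.swap (N, i) (N, j) with hσ
  have hσ1 : ∀ p, (σ p).1 = p.1 := fun p => by
    rw [hσ, Equiv.swap_apply_def]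
    split_ifs with h h' <;> simp [*]
  have hσv : ∀ p, validLabel κ (σ p) ↔ validLabel κ p := fun p => by
    rw [hσ, Equiv.swap_apply_def]
    split_ifs with h h' <;> simp [*]
  have h0 : σ (0, 0) = (0, 0) :=
    Equiv.swap_apply_of_ne_of_ne (fun h => by simp at h; omega) (fun h => by simp at h; omega)
  have hl := labl_permuteBlocks (fun p => (hσv p).2) h0
  refine measure_offDiag_of_isMinimiser (T := permuteBlocks κ σ) hb (measurable_Ccont a b κ) hε hP
    hfin huniq
    (measurePreserving_permuteBlocks σ fun p => by simp only [labelMass, hσv, hσ1])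
    (permuteBlocks_permuteBlocks (fun p => (hσv p).2) h0 (Equiv.swap_apply_self _ _)) ?_
    (measurableSet_Iab κ N i) (measurableSet_Iab κ N j) ?_ ?_ ?_ ?_
  · intro x y
    simp only [Ccont, hl]
    exact CdPair_swap a b hi1 hj1 _ _
  · rw [Set.disjoint_left]
    intro x hx hx'
    exact hij (congrArg Prod.snd (label_unique hvi hvj hx hx'))
  · intro x
    have hEi : permuteBlocks κ σ x ∈ Iab κ N i ↔ labl κ (permuteBlocks κ σ x) = (N, i) := by
      rw [← preimage_labl hvi]; rfl
    have hEj : x ∈ Iab κ N j ↔ labl κ x = (N, j) := by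
      rw [← preimage_labl hvj]; rfl
    rw [hEi, hEj, hl, ← Equiv.swap_apply_right (N, i) (N, j), ← hσ, σ.apply_eq_iff_eq]
  · rintro x y (⟨hx, hy⟩ | ⟨hx, hy⟩)
    · exact Ccont_eq_zero a b κ ((labl_eq hvi hy).trans (labl_eq hvi hx).symm)
    · exact Ccont_eq_zero a b κ ((labl_eq hvj hy).trans (labl_eq hvj hx).symm)
  · rintro x y (⟨hx, hy⟩ | ⟨hx, hy⟩)
    · simp [Ccont, CdPair, labl_eq hvj hx, labl_eq hvi hy, hij.symm, Nat.ne_of_gt hi1,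
        Nat.ne_of_gt hj1]
    · simp [Ccont, CdPair, labl_eq hvi hx, labl_eq hvj hy, hij, Nat.ne_of_gt hi1,
        Nat.ne_of_gt hj1]

lemma tendsto_mul_elog {F : ℝ → ℝ≥0∞} {p : ℝ → ℝ} {b m : ℝ} (hm : 0 < m)
    (hF : ∀ᶠ ε in 𝓝[>] (0 : ℝ), (F ε).toReal = Real.exp (-b / ε) * p ε)
    (hp : ∀ᶠ ε in 𝓝[>] (0 : ℝ), m ≤ p ε ∧ p ε ≤ 1) :
    Tendsto (fun ε : ℝ => (ε : EReal) * elog (F ε)) (𝓝[>] (0 : ℝ)) (𝓝 ((-b : ℝ) : EReal)) := by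
  have hid : Tendsto (fun ε : ℝ => ε) (𝓝[>] (0 : ℝ)) (𝓝 0) := nhdsWithin_le_nhds
  have hlog : Tendsto (fun ε => ε * Real.log (p ε)) (𝓝[>] (0 : ℝ)) (𝓝 0) := by
    have hlow : Tendsto (fun ε : ℝ => ε * Real.log m) (𝓝[>] (0 : ℝ)) (𝓝 0) := by
      simpa using hid.mul_const (Real.log m)
    refine tendsto_of_tendsto_of_tendsto_of_le_of_le' hlow tendsto_const_nhds ?_ ?_
    · filter_upwards [hp, self_mem_nhdsWithin] with ε h hε
      exact mul_le_mul_of_nonneg_left (Real.log_le_log hm h.1) (le_of_lt hε)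
    · filter_upwards [hp, self_mem_nhdsWithin] with ε h hε
      exact mul_nonpos_of_nonneg_of_nonpos (le_of_lt hε)
        (Real.log_nonpos (hm.le.trans h.1) h.2)
  have hreal : Tendsto (fun ε => ((-b + ε * Real.log (p ε) : ℝ) : EReal)) (𝓝[>] (0 : ℝ))
      (𝓝 ((-b : ℝ) : EReal)) := by
    have := (tendsto_const_nhds (x := -b)).add hlog
    rw [add_zero] at this
    exact (continuous_coe_real_ereal.tendsto _).comp this
  refine hreal.congr' ?_
  filter_upwards [hF, hp, self_mem_nhdsWithin] with ε h1 h2 hε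
  have hp0 : 0 < p ε := hm.trans_le h2.1
  have hpos : 0 < (F ε).toReal := by
    rw [h1]
    positivity
  have hF' := ENNReal.toReal_pos_iff.1 hpos
  have hε' : ε ≠ 0 := ne_of_gt hε
  rw [elog, if_neg hF'.1.ne', if_neg hF'.2.ne, h1, Real.log_mul (Real.exp_ne_zero _) hp0.ne',
    Real.log_exp, ← EReal.coe_mul]
  congr 1
  field_simp

lemma eventually_le_measure_diag {a b κ : ℝ} (ha : 0 < a) (hab : a ≤ b) {N j : ℕ}
    (hv : validLabel κ (N, j)) {P : ℝ → Measure (ℝ × ℝ)}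
    (hP : ∀ ε : ℝ, 0 < ε → P ε ∈ couplings (muC κ) (muC κ)) {K : ℝ≥0∞} (hK : K ≠ ⊤)
    (hcost : ∀ ε : ℝ, 0 < ε →
      ∫⁻ z, ENNReal.ofReal (Ccont a b κ z) ∂(P ε) ≤ ENNReal.ofReal ε * K) :
    ∀ᶠ ε in 𝓝[>] (0 : ℝ), (labelMass κ (N, j) / 2).toReal ≤
      (P ε (Iab κ N j ×ˢ Iab κ N j)).toReal := by
  have hc : ENNReal.ofReal (min a 1) ≠ 0 := by
    rw [Ne, ENNReal.ofReal_eq_zero, not_le]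
    exact lt_min ha one_pos
  have hm := labelMass_pos hv
  have hmt : labelMass κ (N, j) ≠ ⊤ := by
    rw [labelMass, if_pos hv]
    exact ENNReal.ofReal_ne_top
  have hlim : Tendsto (fun ε : ℝ => ENNReal.ofReal ε * (K / ENNReal.ofReal (min a 1)))
      (𝓝[>] 0) (𝓝 0) := by
    have h : Tendsto (fun ε : ℝ => ENNReal.ofReal ε) (𝓝[>] 0) (𝓝 0) := by
      simpa using (ENNReal.continuous_ofReal.tendsto 0).mono_left nhdsWithin_le_nhds
    simpa using ENNReal.Tendsto.mul_const h (Or.inr (ENNReal.div_ne_top hK hc))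
  filter_upwards [hlim.eventually (gt_mem_nhds (ENNReal.half_pos hm.ne')), self_mem_nhdsWithin]
    with ε h hε
  have := (hP ε hε).1
  have key := labelMass_le_add_cost ha hab hv (hP ε hε)
  refine ENNReal.toReal_mono (measure_ne_top _ _) ?_
  have h2 : labelMass κ (N, j) / 2 + labelMass κ (N, j) / 2 ≤
      P ε (Iab κ N j ×ˢ Iab κ N j) + labelMass κ (N, j) / 2 := by
    rw [ENNReal.add_halves]
    refine key.trans (add_le_add_right (le_trans ?_ h.le) _)
    rw [← mul_div_assoc]
    exact ENNReal.div_le_div_right (hcost ε hε) _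
  exact (ENNReal.add_le_add_iff_right (ENNReal.div_ne_top hmt two_ne_zero)).1 h2

/-- **Decay exponent on a fixed off-diagonal rectangle** (Lemma 4.6): for `N ≥ 1` and
`1 ≤ i ≠ j ≤ m_N`, the rectangle `R_{N,i,j} = I_{N,i} × I_{N,j}` is clopen in `X × X` and
`lim_{ε↓0} ε log P_ε(R_{N,i,j}) = −b`. -/
theorem fixed_rectangle_decay_exponent
    (a b κ : ℝ) (ha : 0 < a) (haκ : 2 * a < κ) (hκb : κ < b)
    (P : ℝ → Measure (ℝ × ℝ))
    (hPmem : ∀ ε : ℝ, 0 < ε → P ε ∈ couplings (muC κ) (muC κ))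
    (hPmin : ∀ ε : ℝ, 0 < ε → ∀ Q ∈ couplings (muC κ) (muC κ),
      Jfun (Ccont a b κ) ((muC κ).prod (muC κ)) ε (P ε) ≤
        Jfun (Ccont a b κ) ((muC κ).prod (muC κ)) ε Q)
    (hPuniq : ∀ ε : ℝ, 0 < ε → ∀ Q ∈ couplings (muC κ) (muC κ),
      (∀ R ∈ couplings (muC κ) (muC κ),
        Jfun (Ccont a b κ) ((muC κ).prod (muC κ)) ε Q ≤
          Jfun (Ccont a b κ) ((muC κ).prod (muC κ)) ε R) → Q = P ε)
    (N i j : ℕ) (hN : 1 ≤ N) (hi1 : 1 ≤ i) (hj1 : 1 ≤ j)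
    (hi : i ≤ mseq κ N) (hj : j ≤ mseq κ N) (hij : i ≠ j) :
    IsOpen {p : Xset κ × Xset κ | (p.1 : ℝ) ∈ Iab κ N i ∧ (p.2 : ℝ) ∈ Iab κ N j} ∧
    IsClosed {p : Xset κ × Xset κ | (p.1 : ℝ) ∈ Iab κ N i ∧ (p.2 : ℝ) ∈ Iab κ N j} ∧
    Tendsto (fun ε : ℝ => (ε : EReal) * elog (P ε (Iab κ N i ×ˢ Iab κ N j)))
      (𝓝[>] (0 : ℝ)) (𝓝 ((-b : ℝ) : EReal)) := by
  have hvi : validLabel κ (N, i) := ⟨hN, hi⟩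
  have hvj : validLabel κ (N, j) := ⟨hN, hj⟩
  have hclopen : IsClopen {p : Xset κ × Xset κ |
      (p.1 : ℝ) ∈ Iab κ N i ∧ (p.2 : ℝ) ∈ Iab κ N j} :=
    ((isClopen_preimage_Iab hvi).preimage continuous_fst).inter
      ((isClopen_preimage_Iab hvj).preimage continuous_snd)
  refine ⟨hclopen.isOpen, hclopen.isClosed, ?_⟩
  have hμ : IsProbabilityMeasure (muC κ) := by
    obtain ⟨h, h1, -⟩ := hPmem 1 one_pos
    exact h1 ▸ Measure.isProbabilityMeasure_map measurable_fst.aemeasurable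
  obtain ⟨K, hK, hJ⟩ := exists_Jfun_le a b (κ := κ) (by linarith)
  have hJle : ∀ ε : ℝ, 0 < ε → Jfun (Ccont a b κ) ((muC κ).prod (muC κ)) ε (P ε) ≤
      ((ENNReal.ofReal ε * K : ℝ≥0∞) : EReal) := fun ε hε => by
    obtain ⟨Q, hQ, hQK⟩ := hJ ε hε
    exact (hPmin ε hε Q hQ).trans hQK
  have hcost : ∀ ε : ℝ, 0 < ε →
      ∫⁻ z, ENNReal.ofReal (Ccont a b κ z) ∂(P ε) ≤ ENNReal.ofReal ε * K := fun ε hε => by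
    have := (hPmem ε hε).1
    have h := hJle ε hε
    rw [Jfun_eq_coe _ _ _ hε, EReal.coe_ennreal_le_coe_ennreal_iff] at h
    exact le_self_add.trans h
  have hm : 0 < (labelMass κ (N, j) / 2).toReal := by
    refine ENNReal.toReal_pos (ENNReal.half_pos (labelMass_pos hvj).ne').ne'
      (ENNReal.div_ne_top ?_ two_ne_zero)
    rw [← muC_Iab hvj]
    exact measure_ne_top _ _
  refine tendsto_mul_elog (p := fun ε => (P ε (Iab κ N j ×ˢ Iab κ N j)).toReal) hm ?_ ?_
  · filter_upwards [self_mem_nhdsWithin] with ε hε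
    refine measure_rectangle_of_isMinimiser (by linarith) hε (hPmem ε hε)
      (ne_top_of_le_ne_top ?_ (hJle ε hε)) (fun Q hQ hQP => ?_) hi1 hj1 hvi hvj hij
    · rw [Ne, EReal.coe_ennreal_eq_top_iff]
      exact ENNReal.mul_ne_top ENNReal.ofReal_ne_top hK
    · exact hPuniq ε hε Q hQ fun R hR => hQP.trans (hPmin ε hε R hR)
  · filter_upwards [self_mem_nhdsWithin,
      eventually_le_measure_diag ha (by linarith) hvj hPmem hK hcost] with ε hε h
    have := (hPmem ε hε).1
    exact ⟨h, ENNReal.toReal_le_of_le_ofReal zero_le_one (by simpa using prob_le_one)⟩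

end
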